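/- The Hensman bound recovers the Titsias bound at the optimal variational parameters with full batch (claim after Equation 7): under the sparse GP setup, let Σ := K_mm + K_Nmᵀ D^{−1} K_Nm, μ_T := K_mm Σ^{−1} K_Nmᵀ D^{−1} ỹ and A_T := K_mm Σ^{−1} K_mm. Then A_T is symmetric positive definite, K_Nm K_mm^{−1} K_Nmᵀ + D is symmetric positive definite, and L_H(μ_T, A_T) = L_T, where L_T := log N(ỹ | 0, K_Nm K_mm^{−1} K_Nmᵀ + D) − (1/2) Tr(D^{−1} K̃) and L_H(μ, A) := ∑_{i=1}^N [ log N(ỹᵢ | kᵢᵀ K_mm^{−1} μ, σ̃ᵢ²) − (1/(2σ̃ᵢ²))(K̃ᵢᵢ + Tr(A Λᵢ)) ] − (1/2)( Tr(K_mm^{−1} A) + μᵀ K_mm^{−1} μ − m + log det K_mm − log det A ). -/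

import Mathlib

open MeasureTheory Matrix Real
open scoped BigOperators

/-- Multivariate Gaussian density `N(x | m, S)`. -/
noncomputable def gaussN {n : ℕ} (m : Fin n → ℝ) (S : Matrix (Fin n) (Fin n) ℝ)
    (x : Fin n → ℝ) : ℝ :=
  (2 * π) ^ (-(n : ℝ) / 2) * S.det ^ (-(1 : ℝ) / 2) *
    Real.exp (-(1 / 2) * ((x - m) ⬝ᵥ (S⁻¹ *ᵥ (x - m))))

/-- One-dimensional Gaussian density `N(x | m, v)` with variance `v`. -/
noncomputable def gauss1 (x m v : ℝ) : ℝ :=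
  (2 * π * v) ^ (-(1 : ℝ) / 2) * Real.exp (-((x - m) ^ 2) / (2 * v))

/-- The logarithm of the one-dimensional Gaussian density. -/
theorem log_gauss1 (x a v : ℝ) (hv : 0 < v) :
    Real.log (gauss1 x a v)
      = -(1 / 2) * Real.log (2 * π) - 1 / 2 * Real.log v - 1 / 2 * (v⁻¹ * (x - a) ^ 2) := by
  have h2π : 0 < 2 * π := by positivity
  have hpos : 0 < (2 * π * v) ^ (-(1 : ℝ) / 2) := by positivity
  rw [gauss1, Real.log_mul hpos.ne' (Real.exp_pos _).ne', Real.log_exp,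
    Real.log_rpow (by positivity), Real.log_mul h2π.ne' hv.ne']
  field_simp
  ring

/-- The logarithm of the multivariate Gaussian density. -/
theorem log_gaussN {n : ℕ} (a : Fin n → ℝ) (S : Matrix (Fin n) (Fin n) ℝ) (x : Fin n → ℝ)
    (hS : 0 < S.det) :
    Real.log (gaussN a S x)
      = -(n / 2) * Real.log (2 * π) - 1 / 2 * Real.log S.det
        - 1 / 2 * ((x - a) ⬝ᵥ (S⁻¹ *ᵥ (x - a))) := by
  have h2π : 0 < (2 * π) ^ (-(n : ℝ) / 2) := by positivity
  have hdet : 0 < S.det ^ (-(1 : ℝ) / 2) := by positivity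
  rw [gaussN, Real.log_mul (mul_pos h2π hdet).ne' (Real.exp_pos _).ne', Real.log_exp,
    Real.log_mul h2π.ne' hdet.ne', Real.log_rpow (by positivity), Real.log_rpow hS]
  ring

section MatrixIdentities

variable {ι κ : Type*} [Fintype ι] [DecidableEq ι] [Fintype κ] [DecidableEq κ]

/-- The generalized matrix determinant lemma, multiplied through by `det K`. -/
theorem det_mul_inv_mul_add_mul_det {R : Type*} [CommRing R] (K : Matrix κ κ R) (D : Matrix ι ι R)
    (B : Matrix ι κ R) (C : Matrix κ ι R) (hK : IsUnit K.det) (hD : IsUnit D.det) :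
    (B * K⁻¹ * C + D).det * K.det = D.det * (K + C * D⁻¹ * B).det := by
  have h₁ : B * K⁻¹ * C + D = D * (1 + (D⁻¹ * B) * (K⁻¹ * C)) := by
    simp only [Matrix.mul_add, Matrix.mul_one, ← Matrix.mul_assoc, mul_nonsing_inv D hD, Matrix.one_mul, add_comm]
  have h₂ : K + C * D⁻¹ * B = K * (1 + (K⁻¹ * C) * (D⁻¹ * B)) := by
    simp only [Matrix.mul_add, Matrix.mul_one, ← Matrix.mul_assoc, mul_nonsing_inv K hK, Matrix.one_mul]
  rw [h₁, h₂, det_mul, det_mul, det_one_add_mul_comm]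
  ring

/-- If `w` solves the normal equations `(K + C D⁻¹ B) w = C D⁻¹ y`, then the residual `y - B w`
gives the solution of the linear system with matrix `B K⁻¹ C + D`. -/
theorem inv_mul_inv_mul_add_mulVec {R : Type*} [CommRing R] (K : Matrix κ κ R) (D : Matrix ι ι R)
    (B : Matrix ι κ R) (C : Matrix κ ι R) (hK : IsUnit K.det) (hD : IsUnit D.det)
    (hKD : IsUnit (B * K⁻¹ * C + D).det) (y : ι → R) (w : κ → R)
    (hw : (K + C * D⁻¹ * B) *ᵥ w = (C * D⁻¹) *ᵥ y) :
    (B * K⁻¹ * C + D)⁻¹ *ᵥ y = D⁻¹ *ᵥ (y - B *ᵥ w) := by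
  have hres : (C * D⁻¹) *ᵥ (y - B *ᵥ w) = K *ᵥ w := by
    rw [mulVec_sub, ← hw, add_mulVec, mulVec_mulVec, add_sub_cancel_right]
  have hsolve : (B * K⁻¹ * C + D) *ᵥ (D⁻¹ *ᵥ (y - B *ᵥ w)) = y := by
    rw [add_mulVec, mulVec_mulVec _ D, mul_nonsing_inv D hD, one_mulVec, mulVec_mulVec,
      Matrix.mul_assoc (B * K⁻¹), ← mulVec_mulVec, hres, mulVec_mulVec, Matrix.mul_assoc,
      nonsing_inv_mul K hK, Matrix.mul_one, add_sub_cancel]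
  conv_lhs => rw [← hsolve]
  rw [mulVec_mulVec, nonsing_inv_mul _ hKD, one_mulVec]

/-- At the minimizer `w` of the regularized least squares objective, its value is the quadratic
form of the marginal precision matrix `(B K⁻¹ Bᵀ + D)⁻¹`. -/
theorem residual_add_penalty_eq {R : Type*} [CommRing R] (K : Matrix κ κ R) (D : Matrix ι ι R)
    (B : Matrix ι κ R) (hK : IsUnit K.det) (hD : IsUnit D.det)
    (hKD : IsUnit (B * K⁻¹ * Bᵀ + D).det) (y : ι → R) (w : κ → R)
    (hw : (K + Bᵀ * D⁻¹ * B) *ᵥ w = (Bᵀ * D⁻¹) *ᵥ y) :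
    (y - B *ᵥ w) ⬝ᵥ (D⁻¹ *ᵥ (y - B *ᵥ w)) + w ⬝ᵥ (K *ᵥ w)
      = y ⬝ᵥ ((B * K⁻¹ * Bᵀ + D)⁻¹ *ᵥ y) := by
  have hres : Bᵀ *ᵥ (D⁻¹ *ᵥ (y - B *ᵥ w)) = K *ᵥ w := by
    rw [mulVec_mulVec, mulVec_sub, ← hw, add_mulVec, mulVec_mulVec, add_sub_cancel_right]
  rw [inv_mul_inv_mul_add_mulVec K D B Bᵀ hK hD hKD y w hw, ← hres, sub_dotProduct,
    dotProduct_mulVec w, vecMul_transpose, sub_add_cancel]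

end MatrixIdentities

theorem stmt13 (N m : ℕ)
    (Kmm : Matrix (Fin m) (Fin m) ℝ) (hKmm : Kmm.PosDef)
    (KNm : Matrix (Fin N) (Fin m) ℝ)
    (KNN : Matrix (Fin N) (Fin N) ℝ) (hKNN : KNN.IsSymm)
    (Ktil : Matrix (Fin N) (Fin N) ℝ) (hKtil : Ktil = KNN - KNm * Kmm⁻¹ * KNmᵀ)
    (Λ : Fin N → Matrix (Fin m) (Fin m) ℝ)
    (hΛ : ∀ i, Λ i = Kmm⁻¹ * vecMulVec (KNm i) (KNm i) * Kmm⁻¹)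
    (ytil : Fin N → ℝ) (σ : Fin N → ℝ) (hσ : ∀ i, 0 < σ i)
    (D : Matrix (Fin N) (Fin N) ℝ) (hD : D = Matrix.diagonal fun i => (σ i) ^ 2)
    (Sig : Matrix (Fin m) (Fin m) ℝ) (hSig : Sig = Kmm + KNmᵀ * D⁻¹ * KNm)
    (μT : Fin m → ℝ) (hμT : μT = (Kmm * Sig⁻¹ * KNmᵀ * D⁻¹) *ᵥ ytil)
    (AT : Matrix (Fin m) (Fin m) ℝ) (hAT : AT = Kmm * Sig⁻¹ * Kmm)
    (LT : ℝ)
    (hLT : LT = Real.log (gaussN 0 (KNm * Kmm⁻¹ * KNmᵀ + D) ytil)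
      - (1 / 2) * (D⁻¹ * Ktil).trace)
    (LH : (Fin m → ℝ) → Matrix (Fin m) (Fin m) ℝ → ℝ)
    (hLH : ∀ (μ : Fin m → ℝ) (A : Matrix (Fin m) (Fin m) ℝ),
      LH μ A =
        (∑ i, (Real.log (gauss1 (ytil i) ((KNm i) ⬝ᵥ (Kmm⁻¹ *ᵥ μ)) ((σ i) ^ 2))
          - (1 / (2 * (σ i) ^ 2)) * (Ktil i i + (A * Λ i).trace)))
        - (1 / 2) * ((Kmm⁻¹ * A).trace + μ ⬝ᵥ (Kmm⁻¹ *ᵥ μ) - m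
          + Real.log Kmm.det - Real.log A.det)) :
    AT.PosDef ∧ (KNm * Kmm⁻¹ * KNmᵀ + D).PosDef ∧ LH μT AT = LT := by
  have hσ2 : ∀ i, 0 < σ i ^ 2 := fun i => pow_pos (hσ i) 2
  have hDpos : D.PosDef := hD ▸ PosDef.diagonal hσ2
  have hDinv : D⁻¹ = Matrix.diagonal fun i => (σ i ^ 2)⁻¹ := by
    refine inv_eq_left_inv ?_
    rw [hD, diagonal_mul_diagonal, ← diagonal_one]
    exact congrArg _ (funext fun i => inv_mul_cancel₀ (hσ2 i).ne')
  have hSigpos : Sig.PosDef := by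
    rw [hSig]
    refine hKmm.add_posSemidef ?_
    simpa [conjTranspose_eq_transpose_of_trivial] using
      hDpos.inv.posSemidef.conjTranspose_mul_mul_same KNm
  have hCpos : (KNm * Kmm⁻¹ * KNmᵀ + D).PosDef := by
    refine PosDef.posSemidef_add ?_ hDpos
    simpa [conjTranspose_eq_transpose_of_trivial] using
      hKmm.inv.posSemidef.mul_mul_conjTranspose_same KNm
  have hKu : IsUnit Kmm.det := hKmm.det_pos.ne'.isUnit
  have hDu : IsUnit D.det := hDpos.det_pos.ne'.isUnit
  have hSu : IsUnit Sig.det := hSigpos.det_pos.ne'.isUnit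
  have hCu : IsUnit (KNm * Kmm⁻¹ * KNmᵀ + D).det := hCpos.det_pos.ne'.isUnit
  have hATpos : AT.PosDef := by
    have h := hSigpos.inv.conjTranspose_mul_mul_same (B := Kmm)
      (mulVec_injective_of_isUnit hKmm.isUnit)
    rwa [hKmm.isHermitian.eq, ← hAT] at h
  refine ⟨hATpos, hCpos, ?_⟩
  set w : Fin m → ℝ := Sig⁻¹ *ᵥ ((KNmᵀ * D⁻¹) *ᵥ ytil) with hw
  have hμw : μT = Kmm *ᵥ w := by
    rw [hμT, hw]
    simp only [mulVec_mulVec, Matrix.mul_assoc]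
  have hKμ : Kmm⁻¹ *ᵥ μT = w := by
    rw [hμw, mulVec_mulVec, nonsing_inv_mul _ hKu, one_mulVec]
  have hnormal : (Kmm + KNmᵀ * D⁻¹ * KNm) *ᵥ w = (KNmᵀ * D⁻¹) *ᵥ ytil := by
    rw [← hSig, hw, mulVec_mulVec, mul_nonsing_inv _ hSu, one_mulVec]
  have hquad := residual_add_penalty_eq Kmm D KNm hKu hDu hCu ytil w hnormal
  have hres : (ytil - KNm *ᵥ w) ⬝ᵥ (D⁻¹ *ᵥ (ytil - KNm *ᵥ w))
      = ∑ i, (σ i ^ 2)⁻¹ * (ytil i - KNm i ⬝ᵥ w) ^ 2 := by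
    rw [hDinv]
    refine Finset.sum_congr rfl fun i _ => ?_
    rw [mulVec_diagonal, Pi.sub_apply, mulVec]
    ring
  have htrace : ∑ i, (σ i ^ 2)⁻¹ * (AT * Λ i).trace + (Kmm⁻¹ * AT).trace = m := by
    have hterm : ∀ i, (AT * Λ i).trace = (KNm * Sig⁻¹ * KNmᵀ) i i := by
      intro i
      have hAΛ : AT * Λ i = Kmm * (Sig⁻¹ * vecMulVec (KNm i) (KNm i) * Kmm⁻¹) := by
        rw [hAT, hΛ]
        simp only [← Matrix.mul_assoc]
        rw [Matrix.mul_assoc _ Kmm Kmm⁻¹, mul_nonsing_inv _ hKu, Matrix.mul_one]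
      rw [hAΛ, trace_mul_comm, Matrix.mul_assoc, nonsing_inv_mul _ hKu, Matrix.mul_one, mul_vecMulVec,
        trace_vecMulVec, dotProduct_comm, Matrix.mul_assoc]
      simp only [mul_apply, dotProduct, mulVec, transpose_apply]
    have hsum : ∑ i, (σ i ^ 2)⁻¹ * (AT * Λ i).trace = (Sig⁻¹ * (KNmᵀ * D⁻¹ * KNm)).trace := by
      have : (Sig⁻¹ * (KNmᵀ * D⁻¹ * KNm)).trace = (D⁻¹ * (KNm * Sig⁻¹ * KNmᵀ)).trace := by
        rw [← Matrix.mul_assoc, ← Matrix.mul_assoc, Matrix.mul_assoc, trace_mul_comm]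
        simp only [Matrix.mul_assoc]
      rw [this, hDinv]
      simp only [hterm]
      simp only [trace, diag_apply, diagonal_mul]
    rw [hsum, hAT, Matrix.mul_assoc Kmm, ← Matrix.mul_assoc Kmm⁻¹, nonsing_inv_mul _ hKu, Matrix.one_mul, ← trace_add,
      ← Matrix.mul_add, add_comm _ Kmm, ← hSig, nonsing_inv_mul _ hSu, trace_one, Fintype.card_fin]
  have hKtiltrace : (D⁻¹ * Ktil).trace = ∑ i, (σ i ^ 2)⁻¹ * Ktil i i := by
    rw [hDinv]
    simp only [trace, diag_apply, diagonal_mul]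
  have hlogdetA : Real.log AT.det = 2 * Real.log Kmm.det - Real.log Sig.det := by
    have hdet : AT.det * Sig.det = Kmm.det * Kmm.det := by
      rw [hAT, det_mul, det_mul, mul_right_comm, _root_.mul_assoc Kmm.det, ← det_mul,
        nonsing_inv_mul _ hSu, det_one, _root_.mul_one]
    have hlog := congrArg Real.log hdet
    rw [Real.log_mul hATpos.det_pos.ne' hSigpos.det_pos.ne',
      Real.log_mul hKmm.det_pos.ne' hKmm.det_pos.ne'] at hlog
    linarith
  have hlogdetC : Real.log (KNm * Kmm⁻¹ * KNmᵀ + D).det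
      = ∑ i, Real.log (σ i ^ 2) + Real.log Sig.det - Real.log Kmm.det := by
    have hlog := congrArg Real.log (det_mul_inv_mul_add_mul_det Kmm D KNm KNmᵀ hKu hDu)
    rw [← hSig, Real.log_mul hCpos.det_pos.ne' hKmm.det_pos.ne',
      Real.log_mul hDpos.det_pos.ne' hSigpos.det_pos.ne'] at hlog
    have hlogD : Real.log D.det = ∑ i, Real.log (σ i ^ 2) := by
      rw [hD, det_diagonal, Real.log_prod fun i _ => (hσ2 i).ne']
    linarith
  have hsplit : ∑ i, (Real.log (gauss1 (ytil i) (KNm i ⬝ᵥ w) (σ i ^ 2))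
        - (1 / (2 * σ i ^ 2)) * (Ktil i i + (AT * Λ i).trace))
      = -(N / 2) * Real.log (2 * π) - 1 / 2 * ∑ i, Real.log (σ i ^ 2)
        - 1 / 2 * ∑ i, (σ i ^ 2)⁻¹ * (ytil i - KNm i ⬝ᵥ w) ^ 2
        - 1 / 2 * ∑ i, (σ i ^ 2)⁻¹ * Ktil i i
        - 1 / 2 * ∑ i, (σ i ^ 2)⁻¹ * (AT * Λ i).trace := by
    have hconst : -((N : ℝ) / 2) * Real.log (2 * π)
        = ∑ _i : Fin N, -(1 / 2) * Real.log (2 * π) := by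
      rw [Finset.sum_const, Finset.card_univ, Fintype.card_fin, nsmul_eq_mul]
      ring
    rw [hconst]
    simp only [Finset.mul_sum, ← Finset.sum_sub_distrib]
    refine Finset.sum_congr rfl fun i _ => ?_
    rw [log_gauss1 _ _ _ (hσ2 i), one_div (2 * σ i ^ 2), mul_inv]
    ring
  rw [hLH, hLT, log_gaussN _ _ _ hCpos.det_pos, hKμ, hsplit, sub_zero, hlogdetA, hlogdetC,
    hKtiltrace, ← hquad, hres, hμw, dotProduct_comm (Kmm *ᵥ w)]
  linarith
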